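/- The second-order differential operator D_J is W_J-symmetric: for all P, Q ∈ Mat_N(ℂ[x]), ∫_{−1}^{1} (P·D_J)(x) W_J(x) Q(x)^* dx = ∫_{−1}^{1} P(x) W_J(x) ((Q·D_J)(x))^* dx. -/

import Mathlib

open Polynomial MeasureTheory Matrix

noncomputable section

abbrev Mat (N : ℕ) := Matrix (Fin N) (Fin N) ℂ

/-- The matrix unit with a `1` in the (1-indexed) entry `(s, t)` and `0` elsewhere. -/
def EU (N : ℕ) (s t : ℕ) : Mat N :=
  Matrix.of fun p q => if (p : ℕ) + 1 = s ∧ (q : ℕ) + 1 = t then 1 else 0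

/-- Evaluation of a matrix polynomial at a real point. -/
def mval {N : ℕ} (P : Polynomial (Mat N)) (x : ℝ) : Mat N :=
  Polynomial.eval ((x : ℂ) • (1 : Mat N)) P

/-- The nilpotent matrix `A = Σ a_{2j-1} E_{2j-1,2j} + Σ a_{2j} E_{2j+1,2j}`. -/
def Amat (N : ℕ) (a : ℕ → ℝ) : Mat N :=
  (∑ j ∈ Finset.Icc 1 (N / 2), (a (2 * j - 1) : ℂ) • EU N (2 * j - 1) (2 * j)) +
  (∑ j ∈ Finset.Icc 1 ((N - 1) / 2), (a (2 * j) : ℂ) • EU N (2 * j + 1) (2 * j))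

/-- `K = Σ_{j=1}^{⌊N/2⌋} E_{2j,2j}`. -/
def Kmat (N : ℕ) : Mat N := ∑ j ∈ Finset.Icc 1 (N / 2), EU N (2 * j) (2 * j)

/-- `T(x) = I + x A`. -/
def Tmat (N : ℕ) (a : ℕ → ℝ) (x : ℝ) : Mat N := 1 + (x : ℂ) • Amat N a

/-- The diagonal Jacobi weight `diag((1−x)^{α₁}(1+x)^{β₁}, …)` (1-indexed `α`, `β`). -/
def jacobiDiag (N : ℕ) (α β : ℕ → ℝ) (x : ℝ) : Mat N :=
  Matrix.diagonal fun i =>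
    (((1 - x) ^ α ((i : ℕ) + 1) * (1 + x) ^ β ((i : ℕ) + 1) : ℝ) : ℂ)

/-- The Jacobi-type weight `W_J(x) = T(x) · diag(…) · T(x)^*`. -/
def WJ (N : ℕ) (a α β : ℕ → ℝ) (x : ℝ) : Mat N :=
  Tmat N a x * jacobiDiag N α β x * (Tmat N a x)ᴴ

/-- `B = diag(β₁−α₁, …, β_N−α_N)`. -/
def BJ (N : ℕ) (α β : ℕ → ℝ) : Mat N :=
  Matrix.diagonal fun i => ((β ((i : ℕ) + 1) - α ((i : ℕ) + 1) : ℝ) : ℂ)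

/-- The right action of the differential operator `D_J`:
`P·D_J = (1−x²)P'' + P'·(2A + B + x(AB − BA + 2K − (α₁+β₁+2)I)) + P·(AB + (α₁+β₁)K)`. -/
def DJ {N : ℕ} (a α β : ℕ → ℝ) (P : Polynomial (Mat N)) : Polynomial (Mat N) :=
  (1 - Polynomial.X ^ 2) * derivative (derivative P)
    + derivative P * (Polynomial.C (2 • Amat N a + BJ N α β)
        + Polynomial.X *
            Polynomial.C (Amat N a * BJ N α β - BJ N α β * Amat N a + 2 • Kmat N
              - ((α 1 + β 1 + 2 : ℝ) : ℂ) • (1 : Mat N)))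
    + P * Polynomial.C (Amat N a * BJ N α β + ((α 1 + β 1 : ℝ) : ℂ) • Kmat N)

theorem intervalIntegrable_jacobiWeight {p q : ℝ} (hp : -1 < p) (hq : -1 < q) :
    IntervalIntegrable (fun x : ℝ => (1 - x) ^ p * (1 + x) ^ q) volume (-1) 1 := by
  have hl : IntervalIntegrable (fun x : ℝ => (1 + x) ^ q) volume (-1) 0 := by
    have h := (intervalIntegral.intervalIntegrable_rpow' (a := 0) (b := 1) hq).comp_add_left 1
    norm_num at h
    exact h
  have hr : IntervalIntegrable (fun x : ℝ => (1 - x) ^ p) volume 0 1 := by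
    have h := (intervalIntegral.intervalIntegrable_rpow' (a := 0) (b := 1) hp).comp_sub_left 1
    norm_num at h
    exact h.symm
  refine IntervalIntegrable.trans (b := 0) (hl.continuousOn_mul ?_) (hr.mul_continuousOn ?_)
  · intro x hx
    rw [Set.uIcc_of_le (by norm_num)] at hx
    refine ContinuousAt.continuousWithinAt (ContinuousAt.rpow_const (by fun_prop) (Or.inl ?_))
    linarith [hx.2]
  · intro x hx
    rw [Set.uIcc_of_le (by norm_num)] at hx
    refine ContinuousAt.continuousWithinAt (ContinuousAt.rpow_const (by fun_prop) (Or.inl ?_))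
    linarith [hx.1]

theorem hasDerivAt_jacobiWeight_succ (p q : ℝ) {x : ℝ} (hx : x ∈ Set.Ioo (-1 : ℝ) 1) :
    HasDerivAt (fun x : ℝ => (1 - x) ^ (p + 1) * (1 + x) ^ (q + 1))
      ((1 - x) ^ p * (1 + x) ^ q * (q - p - (p + q + 2) * x)) x := by
  have h1 : 0 < 1 - x := by linarith [hx.2]
  have h2 : 0 < 1 + x := by linarith [hx.1]
  have hu : HasDerivAt (fun x : ℝ => (1 - x) ^ (p + 1)) _ x :=
    ((hasDerivAt_id x).const_sub 1).rpow_const (p := p + 1) (Or.inl h1.ne')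
  have hv : HasDerivAt (fun x : ℝ => (1 + x) ^ (q + 1)) _ x :=
    ((hasDerivAt_id x).const_add 1).rpow_const (p := q + 1) (Or.inl h2.ne')
  refine (hu.mul hv).congr_deriv ?_
  simp only [id, add_sub_cancel_right, Real.rpow_add_one h1.ne', Real.rpow_add_one h2.ne']
  ring

/-- The scalar Jacobi operator, shifted by a constant `c`, applied to a function with value `r₀`,
derivative `r₁` and second derivative `r₂` at `x`. -/
def jacobiOp (p q c x : ℝ) (r₀ r₁ r₂ : ℂ) : ℂ :=
  ((1 - x ^ 2 : ℝ) : ℂ) * r₂ + ((q - p - (p + q + 2) * x : ℝ) : ℂ) * r₁ + (c : ℂ) * r₀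

theorem integrableOn_jacobiWeight_mul {p q : ℝ} (hp : -1 < p) (hq : -1 < q) {f : ℝ → ℂ}
    (hf : Continuous f) :
    IntegrableOn (fun x : ℝ => (((1 - x) ^ p * (1 + x) ^ q : ℝ) : ℂ) * f x)
      (Set.Ioo (-1 : ℝ) 1) := by
  have hw := intervalIntegrable_jacobiWeight hp hq
  have h : IntervalIntegrable (fun x : ℝ => (((1 - x) ^ p * (1 + x) ^ q : ℝ) : ℂ)) volume (-1) 1 :=
    ⟨hw.1.ofReal, hw.2.ofReal⟩
  exact (intervalIntegrable_iff_integrableOn_Ioo_of_le (by norm_num)).1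
    (h.mul_continuousOn hf.continuousOn)

/-- The scalar Jacobi operator is symmetric with respect to the Jacobi weight. -/
theorem integral_jacobiOp_symm {p q : ℝ} (hp : -1 < p) (hq : -1 < q) (c : ℝ)
    {r₀ r₁ r₂ s₀ s₁ s₂ : ℝ → ℂ}
    (hr₀ : ∀ x, HasDerivAt r₀ (r₁ x) x) (hr₁ : ∀ x, HasDerivAt r₁ (r₂ x) x)
    (hr₂ : Continuous r₂)
    (hs₀ : ∀ x, HasDerivAt s₀ (s₁ x) x) (hs₁ : ∀ x, HasDerivAt s₁ (s₂ x) x)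
    (hs₂ : Continuous s₂) :
    ∫ x in Set.Ioo (-1 : ℝ) 1, (((1 - x) ^ p * (1 + x) ^ q : ℝ) : ℂ) *
        (jacobiOp p q c x (r₀ x) (r₁ x) (r₂ x) * star (s₀ x))
      = ∫ x in Set.Ioo (-1 : ℝ) 1, (((1 - x) ^ p * (1 + x) ^ q : ℝ) : ℂ) *
        (r₀ x * star (jacobiOp p q c x (s₀ x) (s₁ x) (s₂ x))) := by
  have cr₀ : Continuous r₀ := continuous_iff_continuousAt.2 fun x => (hr₀ x).continuousAt
  have cr₁ : Continuous r₁ := continuous_iff_continuousAt.2 fun x => (hr₁ x).continuousAt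
  have cs₀ : Continuous s₀ := continuous_iff_continuousAt.2 fun x => (hs₀ x).continuousAt
  have cs₁ : Continuous s₁ := continuous_iff_continuousAt.2 fun x => (hs₁ x).continuousAt
  have i₁ := integrableOn_jacobiWeight_mul hp hq
    (f := fun x => jacobiOp p q c x (r₀ x) (r₁ x) (r₂ x) * star (s₀ x))
    (by unfold jacobiOp; fun_prop)
  have i₂ := integrableOn_jacobiWeight_mul hp hq
    (f := fun x => r₀ x * star (jacobiOp p q c x (s₀ x) (s₁ x) (s₂ x)))
    (by unfold jacobiOp; fun_prop)
  rw [← sub_eq_zero, ← integral_sub i₁ i₂, ← integral_Ioc_eq_integral_Ioo,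
    ← intervalIntegral.integral_of_le (by norm_num),
    intervalIntegral.integral_eq_sub_of_hasDerivAt_of_le (by norm_num)
      (f := fun x => (((1 - x) ^ (p + 1) * (1 + x) ^ (q + 1) : ℝ) : ℂ) *
        (r₁ x * star (s₀ x) - r₀ x * star (s₁ x)))]
  · have hp' : p + 1 ≠ 0 := by linarith
    have hq' : q + 1 ≠ 0 := by linarith
    simp [Real.zero_rpow hp', Real.zero_rpow hq']
  · refine Continuous.continuousOn (Continuous.mul (Complex.continuous_ofReal.comp
      (Continuous.mul ?_ ?_)) (by fun_prop))
    · exact Continuous.rpow_const (by fun_prop) fun x => Or.inr (by linarith)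
    · exact Continuous.rpow_const (by fun_prop) fun x => Or.inr (by linarith)
  · intro x hx
    have h1 : 0 < 1 - x := by linarith [hx.2]
    have h2 : 0 < 1 + x := by linarith [hx.1]
    refine ((hasDerivAt_jacobiWeight_succ p q hx).ofReal_comp.mul
      (((hr₁ x).mul (hs₀ x).star).sub ((hr₀ x).mul (hs₁ x).star))).congr_deriv ?_
    rw [Real.rpow_add_one h1.ne', Real.rpow_add_one h2.ne']
    simp only [Pi.sub_apply, Pi.mul_apply, jacobiOp, star_add, star_mul', Complex.star_def, Complex.conj_ofReal]
    push_cast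
    ring
  · rw [intervalIntegrable_iff_integrableOn_Ioo_of_le (by norm_num)]
    exact i₁.sub i₂

theorem mval_add {N : ℕ} (P Q : Polynomial (Mat N)) (x : ℝ) :
    mval (P + Q) x = mval P x + mval Q x := eval_add

theorem mval_mul {N : ℕ} (P Q : Polynomial (Mat N)) (x : ℝ) :
    mval (P * Q) x = mval P x * mval Q x :=
  eval₂_mul_noncomm _ _ fun _ => (Commute.one_right _).smul_right _

theorem mval_C {N : ℕ} (M : Mat N) (x : ℝ) : mval (C M) x = M := eval_C

theorem mval_X {N : ℕ} (x : ℝ) : mval (X : Polynomial (Mat N)) x = (x : ℂ) • 1 := eval_X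

theorem mval_monomial {N : ℕ} (n : ℕ) (M : Mat N) (x : ℝ) :
    mval (monomial n M) x = (x : ℂ) ^ n • M := by
  rw [mval, eval_monomial, _root_.smul_pow, one_pow, mul_smul_comm, mul_one]

theorem mval_one_sub_X_sq {N : ℕ} (x : ℝ) :
    mval (1 - X ^ 2 : Polynomial (Mat N)) x = (1 - (x : ℂ) ^ 2) • 1 := by
  have h : mval (1 - X ^ 2 : Polynomial (Mat N)) x = mval 1 x - mval (monomial 2 1) x := by
    rw [monomial_one_right_eq_X_pow]
    exact eval_sub ..
  rw [h, mval_monomial, sub_smul, one_smul]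
  simp [mval]

theorem hasDerivAt_mval_apply {N : ℕ} (P : Polynomial (Mat N)) (i j : Fin N) (x : ℝ) :
    HasDerivAt (fun y => mval P y i j) (mval (derivative P) x i j) x := by
  induction P using Polynomial.induction_on' with
  | add P Q hP hQ =>
    simp only [derivative_add, mval_add, Matrix.add_apply]
    exact hP.add hQ
  | monomial n M =>
    simp only [derivative_monomial, mval_monomial, Matrix.smul_apply, smul_eq_mul]
    refine (((hasDerivAt_id x).ofReal_comp.pow n).mul_const (M i j)).congr_deriv ?_
    rw [← nsmul_eq_mul', Matrix.smul_apply, nsmul_eq_mul]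
    simp
    ring

theorem continuous_mval_apply {N : ℕ} (P : Polynomial (Mat N)) (i j : Fin N) :
    Continuous fun x => mval P x i j :=
  continuous_iff_continuousAt.2 fun x => (hasDerivAt_mval_apply P i j x).continuousAt

/-- Multiplication by `T(x)` on the right, as a matrix polynomial. -/
def mulT {N : ℕ} (a : ℕ → ℝ) (P : Polynomial (Mat N)) : Polynomial (Mat N) :=
  P * (1 + X * C (Amat N a))

theorem mval_mulT {N : ℕ} (a : ℕ → ℝ) (P : Polynomial (Mat N)) (x : ℝ) :
    mval (mulT a P) x = mval P x * Tmat N a x := by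
  rw [mulT, mval_mul, Tmat, mval_add, mval_mul, mval_X, mval_C]
  simp [mval]

theorem mval_derivative_mulT {N : ℕ} (a : ℕ → ℝ) (P : Polynomial (Mat N)) (x : ℝ) :
    mval (derivative (mulT a P)) x
      = mval (derivative P) x * Tmat N a x + mval P x * Amat N a := by
  have h : derivative (mulT a P) = mulT a (derivative P) + P * C (Amat N a) := by
    simp [mulT, derivative_mul]
  rw [h, mval_add, mval_mulT, mval_mul, mval_C]

theorem mval_derivative_derivative_mulT {N : ℕ} (a : ℕ → ℝ) (P : Polynomial (Mat N)) (x : ℝ) :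
    mval (derivative (derivative (mulT a P))) x
      = mval (derivative (derivative P)) x * Tmat N a x
        + (2 : ℂ) • (mval (derivative P) x * Amat N a) := by
  have h : derivative (derivative (mulT a P))
      = mulT a (derivative (derivative P)) + (derivative P * C (Amat N a)
        + derivative P * C (Amat N a)) := by
    simp [mulT, derivative_mul, add_assoc]
  rw [h, mval_add, mval_mulT, mval_add, mval_mul, mval_C, two_smul]

/-- The indicator of the even (1-indexed) positions. -/
def evenInd {N : ℕ} (i : Fin N) : ℝ := if Even ((i : ℕ) + 1) then 1 else 0

theorem Kmat_eq_diagonal (N : ℕ) : Kmat N = diagonal fun i => ((evenInd i : ℝ) : ℂ) := by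
  ext i j
  have hi := i.isLt
  simp only [Kmat, EU, Matrix.sum_apply, Matrix.of_apply, diagonal_apply, evenInd]
  by_cases hij : i = j
  · subst hij
    by_cases he : Even ((i : ℕ) + 1)
    · obtain ⟨k, hk⟩ := he
      rw [Finset.sum_eq_single k]
      · simp [hk, two_mul]
      · intro b _ hb
        rw [if_neg]; omega
      · intro h
        exact absurd (Finset.mem_Icc.2 ⟨by omega, by omega⟩) h
    · rw [Finset.sum_eq_zero]
      · simp [he]
      · intro b _
        rw [if_neg]
        rintro ⟨h, -⟩
        exact he ⟨b, by omega⟩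
  · rw [if_neg hij]
    refine Finset.sum_eq_zero fun b _ => if_neg ?_
    rintro ⟨h1, h2⟩
    exact hij (Fin.ext (by omega))

theorem Amat_apply_eq_zero {N : ℕ} (a : ℕ → ℝ) {i j : Fin N}
    (h : Even ((i : ℕ) + 1) ∨ ¬ Even ((j : ℕ) + 1)) : Amat N a i j = 0 := by
  simp only [Nat.even_iff] at h
  simp only [Amat, EU, Matrix.add_apply, Matrix.sum_apply, Matrix.smul_apply, Matrix.of_apply]
  rw [Finset.sum_eq_zero, Finset.sum_eq_zero, add_zero]
  all_goals
    intro b hb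
    rw [Finset.mem_Icc] at hb
    rw [if_neg (by omega), smul_zero]

theorem Amat_mul_Kmat {N : ℕ} (a : ℕ → ℝ) : Amat N a * Kmat N = Amat N a := by
  ext i j
  rw [Kmat_eq_diagonal, mul_diagonal, evenInd]
  split_ifs with h
  · simp
  · simp [Amat_apply_eq_zero a (Or.inr h)]

theorem Kmat_mul_Amat {N : ℕ} (a : ℕ → ℝ) : Kmat N * Amat N a = 0 := by
  ext i j
  rw [Kmat_eq_diagonal, diagonal_mul, evenInd]
  split_ifs with h
  · simp [Amat_apply_eq_zero a (Or.inl h)]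
  · simp

theorem Amat_mul_Amat {N : ℕ} (a : ℕ → ℝ) : Amat N a * Amat N a = 0 := by
  nth_rw 1 [← Amat_mul_Kmat a]
  rw [mul_assoc, Kmat_mul_Amat, mul_zero]

theorem Amat_mul_BJ_mul_Amat {N : ℕ} (a α β : ℕ → ℝ) :
    Amat N a * BJ N α β * Amat N a = 0 := by
  have h : Kmat N * BJ N α β = BJ N α β * Kmat N := by
    rw [Kmat_eq_diagonal, BJ, diagonal_mul_diagonal, diagonal_mul_diagonal]
    simp only [mul_comm]
  nth_rw 1 [← Amat_mul_Kmat a]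
  rw [mul_assoc (Amat N a), h, mul_assoc, mul_assoc, Kmat_mul_Amat, mul_zero, mul_zero]

/-- The algebraic identity behind the conjugation of `D_J` by `T`. -/
theorem conj_identity {R : Type*} [Ring R] [Algebra ℂ R] (A B K P₀ P₁ P₂ : R) (x c : ℂ)
    (hAK : A * K = A) (hKA : K * A = 0) (hAA : A * A = 0) (hABA : A * B * A = 0) :
    ((1 - x ^ 2) • P₂
        + P₁ * (2 • A + B + x • (A * B - B * A + 2 • K - (c + 2) • (1 : R)))
        + P₀ * (A * B + c • K)) * (1 + x • A)
      = (1 - x ^ 2) • (P₂ * (1 + x • A) + (2 : ℂ) • (P₁ * A))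
        + (P₁ * (1 + x • A) + P₀ * A) * (B + x • (2 • K - (c + 2) • (1 : R)))
        + c • (P₀ * (1 + x • A) * K) := by
  have hABA' : A * (B * A) = 0 := by rw [← mul_assoc, hABA]
  simp only [mul_add, add_mul, mul_sub, sub_mul, smul_mul_assoc, mul_smul_comm, smul_add,
    smul_sub, mul_assoc, hAK, hKA, hAA, hABA', mul_one, mul_zero, smul_zero]
  module

theorem mval_DJ_mul_Tmat {N : ℕ} (a α β : ℕ → ℝ) (P : Polynomial (Mat N)) (x : ℝ) :
    mval (DJ a α β P) x * Tmat N a x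
      = (1 - (x : ℂ) ^ 2) • mval (derivative (derivative (mulT a P))) x
        + mval (derivative (mulT a P)) x * (BJ N α β
            + (x : ℂ) • (2 • Kmat N - (((α 1 + β 1 : ℝ) : ℂ) + 2) • (1 : Mat N)))
        + ((α 1 + β 1 : ℝ) : ℂ) • (mval (mulT a P) x * Kmat N) := by
  rw [mval_derivative_derivative_mulT, mval_derivative_mulT, mval_mulT]
  unfold Tmat
  rw [← conj_identity _ _ _ _ _ _ _ _ (Amat_mul_Kmat a) (Kmat_mul_Amat a) (Amat_mul_Amat a)
    (Amat_mul_BJ_mul_Amat a α β)]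
  simp only [DJ, mval_add, mval_mul, mval_C, mval_X, mval_one_sub_X_sq, smul_mul_assoc, one_mul]
  push_cast
  rfl

theorem mval_DJ_mul_Tmat_apply {N : ℕ} (a α β : ℕ → ℝ)
    (hsum : ∀ j, 1 ≤ j → j ≤ N → α 1 + β 1 = α j + β j + 1 + (-1 : ℝ) ^ j)
    (P : Polynomial (Mat N)) (x : ℝ) (s k : Fin N) :
    (mval (DJ a α β P) x * Tmat N a x) s k
      = jacobiOp (α (k + 1)) (β (k + 1)) ((α 1 + β 1) * evenInd k) x
          (mval (mulT a P) x s k) (mval (derivative (mulT a P)) x s k)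
          (mval (derivative (derivative (mulT a P))) x s k) := by
  have hD : BJ N α β + (x : ℂ) • (2 • Kmat N - (((α 1 + β 1 : ℝ) : ℂ) + 2) • (1 : Mat N))
      = diagonal fun i : Fin N => ((β (i + 1) - α (i + 1)
          - (α (i + 1) + β (i + 1) + 2) * x : ℝ) : ℂ) := by
    rw [Kmat_eq_diagonal, BJ, two_nsmul]
    ext i j
    by_cases hij : i = j
    · subst hij
      have h := hsum (i + 1) (by omega) (by omega)
      have he : α 1 + β 1 + 2 - 2 * evenInd i = α (i + 1) + β (i + 1) + 2 := by
        rw [evenInd]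
        split_ifs with hi
        · rw [hi.neg_one_pow] at h
          linarith
        · rw [(Nat.not_even_iff_odd.1 hi).neg_one_pow] at h
          linarith
      have he' := congrArg Complex.ofReal he
      push_cast at he'
      simp only [Matrix.add_apply, Matrix.sub_apply, Matrix.smul_apply, diagonal_apply_eq,
        Matrix.one_apply_eq, smul_eq_mul]
      push_cast
      linear_combination (-(x : ℂ)) * he'
    · simp [hij]
  rw [mval_DJ_mul_Tmat, hD, Kmat_eq_diagonal]
  simp only [Matrix.add_apply, Matrix.smul_apply, mul_diagonal, smul_eq_mul, jacobiOp]
  push_cast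
  ring

theorem mul_WJ_mul_conjTranspose_apply {N : ℕ} (a α β : ℕ → ℝ) (M L : Mat N) (x : ℝ)
    (s t : Fin N) :
    (M * WJ N a α β x * Lᴴ) s t
      = ∑ k : Fin N, (((1 - x) ^ α ((k : ℕ) + 1) * (1 + x) ^ β ((k : ℕ) + 1) : ℝ) : ℂ)
          * ((M * Tmat N a x) s k * star ((L * Tmat N a x) t k)) := by
  have h : M * WJ N a α β x * Lᴴ
      = M * Tmat N a x * jacobiDiag N α β x * (L * Tmat N a x)ᴴ := by
    simp only [WJ, conjTranspose_mul, mul_assoc]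
  rw [h, Matrix.mul_apply]
  refine Finset.sum_congr rfl fun k _ => ?_
  rw [jacobiDiag, mul_diagonal, conjTranspose_apply]
  ring

/-- the second-order differential operator `D_J` is `W_J`-symmetric. -/
theorem stmt5 (N : ℕ) (hN : 2 ≤ N) (a : ℕ → ℝ)
    (ha : ∀ j, 1 ≤ j → j ≤ N - 1 → a j ≠ 0)
    (α β : ℕ → ℝ)
    (hαβ : ∀ j, 1 ≤ j → j ≤ N → -1 < α j ∧ -1 < β j)
    (hsum : ∀ j, 1 ≤ j → j ≤ N → α 1 + β 1 = α j + β j + 1 + (-1 : ℝ) ^ j)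
    (hint : ∀ i j, 1 ≤ i → i ≤ N → 1 ≤ j → j ≤ N → i ≠ j →
      (¬ ∃ k : ℤ, α i - α j = (k : ℝ)) ∨ (¬ ∃ k : ℤ, β i - β j = (k : ℝ))) :
    ∀ P Q : Polynomial (Mat N), ∀ s t : Fin N,
      ∫ x in Set.Ioo (-1 : ℝ) 1, (mval (DJ a α β P) x * WJ N a α β x * (mval Q x)ᴴ) s t
        = ∫ x in Set.Ioo (-1 : ℝ) 1,
            (mval P x * WJ N a α β x * (mval (DJ a α β Q) x)ᴴ) s t := by
  intro P Q s t
  simp only [mul_WJ_mul_conjTranspose_apply, mval_DJ_mul_Tmat_apply a α β hsum, ← mval_mulT]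
  have hw (k : Fin N) : -1 < α (k + 1) ∧ -1 < β (k + 1) := hαβ _ (by omega) (by omega)
  have hc (R : Polynomial (Mat N)) (i k : Fin N) : Continuous fun x => mval R x i k :=
    continuous_mval_apply R i k
  rw [integral_finsetSum _ fun k _ => ?_, integral_finsetSum _ fun k _ => ?_]
  · exact Finset.sum_congr rfl fun k _ =>
      integral_jacobiOp_symm (hw k).1 (hw k).2 _ (hasDerivAt_mval_apply _ s k)
        (hasDerivAt_mval_apply _ s k) (hc _ s k) (hasDerivAt_mval_apply _ t k)
        (hasDerivAt_mval_apply _ t k) (hc _ t k)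
  · refine integrableOn_jacobiWeight_mul (hw k).1 (hw k).2 ?_
    unfold jacobiOp
    fun_prop
  · refine integrableOn_jacobiWeight_mul (hw k).1 (hw k).2 ?_
    unfold jacobiOp
    fun_prop
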